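/- For all α, β ∈ SL₂(ℤ) one has A(α,β)·A(RαR, RβR) = B(α)·B(β)·B(αβ). -/

import Mathlib

open Matrix

noncomputable section

abbrev GL2Z := GL (Fin 2) ℤ

/-- The Hilbert symbol at the infinite place of `ℚ`:
`(a,b) = -1` if `a < 0` and `b < 0`, and `(a,b) = 1` otherwise. -/
def hilb (a b : ℚ) : ℤˣ := if a < 0 ∧ b < 0 then -1 else 1

/-- Kubota's function `χ`: for `γ = [[a,b],[c,d]]`, `χ(γ) = c` if `c ≠ 0`, else `χ(γ) = d`. -/
def chi (γ : GL2Z) : ℤ :=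
  if (γ : Matrix (Fin 2) (Fin 2) ℤ) 1 0 = 0 then (γ : Matrix (Fin 2) (Fin 2) ℤ) 1 1
  else (γ : Matrix (Fin 2) (Fin 2) ℤ) 1 0

/-- The determinant of an element of `GL₂(ℤ)`, as an integer. -/
def detZ (γ : GL2Z) : ℤ := ((γ : Matrix (Fin 2) (Fin 2) ℤ)).det

/-- Kubota's twisted 2-cocycle
`A(α,β) = (det α, det β)·(χ(αβ)/χ(α), χ(αβ)/(χ(β)·det α))`. -/
def KA (α β : GL2Z) : ℤˣ :=
  hilb (detZ α) (detZ β) *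
    hilb ((chi (α * β) : ℚ) / (chi α : ℚ))
      ((chi (α * β) : ℚ) / ((chi β : ℚ) * (detZ α : ℚ)))

/-- The matrix `R = [[-1,0],[0,1]]` as an element of `GL₂(ℤ)`. -/
def Rm : GL2Z :=
  ⟨!![-1, 0; 0, 1], !![-1, 0; 0, 1],
    by rw [Matrix.mul_fin_two, Matrix.one_fin_two]; norm_num,
    by rw [Matrix.mul_fin_two, Matrix.one_fin_two]; norm_num⟩

/-- `B(γ) = (χ(γ), χ(γR))`. -/
def KB (γ : GL2Z) : ℤˣ := hilb (chi γ) (chi (γ * Rm))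

/-- On quotients of nonzero integers the Hilbert symbol is determined by the signs. -/
lemma hilb_div_div {x y z : ℤ} (hx : x ≠ 0) (hy : y ≠ 0) (hz : z ≠ 0) :
    hilb ((z : ℚ) / x) ((z : ℚ) / y) =
      if ¬(z < 0 ↔ x < 0) ∧ ¬(z < 0 ↔ y < 0) then -1 else 1 := by
  have key (w : ℤ) (hw : w ≠ 0) : (z : ℚ) / w < 0 ↔ ¬(z < 0 ↔ w < 0) := by
    rw [div_neg_iff]
    norm_cast
    omega
  simp only [hilb, key x hx, key y hy]

lemma hilb_intCast (x y : ℤ) : hilb x y = if x < 0 ∧ y < 0 then -1 else 1 := by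
  simp [hilb]

lemma detZ_eq (γ : GL2Z) :
    detZ γ = γ.val 0 0 * γ.val 1 1 - γ.val 0 1 * γ.val 1 0 :=
  Matrix.det_fin_two _

lemma chi_ne_zero {γ : GL2Z} (h : detZ γ = 1) : chi γ ≠ 0 := by
  rw [detZ_eq] at h
  unfold chi
  split_ifs with hc
  · intro hd
    simp [hc, hd] at h
  · exact hc

lemma detZ_mul (α β : GL2Z) : detZ (α * β) = detZ α * detZ β := by
  simp [detZ, Matrix.det_mul]

lemma detZ_Rm : detZ Rm = -1 := by
  simp [detZ, Rm, Matrix.det_fin_two]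

lemma detZ_conj (γ : GL2Z) : detZ (Rm * γ * Rm) = detZ γ := by
  simp [detZ_mul, detZ_Rm]

lemma Rm_mul_Rm : Rm * Rm = 1 := by
  ext i j
  fin_cases i <;> fin_cases j <;> simp [Rm]

lemma conj_mul_conj (α β : GL2Z) :
    Rm * α * Rm * (Rm * β * Rm) = Rm * (α * β) * Rm := by
  calc Rm * α * Rm * (Rm * β * Rm) = Rm * α * (Rm * Rm) * β * Rm := by group
    _ = Rm * (α * β) * Rm := by rw [Rm_mul_Rm]; group

lemma chi_mul_Rm (γ : GL2Z) :
    chi (γ * Rm) = if γ.val 1 0 = 0 then γ.val 1 1 else -γ.val 1 0 := by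
  simp [chi, Rm, Matrix.mul_apply, Fin.sum_univ_two]

lemma chi_conj (γ : GL2Z) :
    chi (Rm * γ * Rm) = if γ.val 1 0 = 0 then γ.val 1 1 else -γ.val 1 0 := by
  simp [chi, Rm, Matrix.mul_apply, Matrix.vecMul, dotProduct, Fin.sum_univ_two]

lemma KA_eq_of_detZ_eq_one {α β : GL2Z} (hα : detZ α = 1) (hβ : detZ β = 1) :
    KA α β = if ¬(chi (α * β) < 0 ↔ chi α < 0) ∧ ¬(chi (α * β) < 0 ↔ chi β < 0)
      then -1 else 1 := by
  have hαβ : detZ (α * β) = 1 := by rw [detZ_mul, hα, hβ, one_mul]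
  rw [KA, hα, hβ, Int.cast_one, mul_one,
    hilb_div_div (chi_ne_zero hα) (chi_ne_zero hβ) (chi_ne_zero hαβ)]
  norm_num [hilb]

lemma KB_eq (γ : GL2Z) : KB γ = if γ.val 1 0 = 0 ∧ γ.val 1 1 < 0 then -1 else 1 := by
  rw [KB, hilb_intCast, chi_mul_Rm, chi]
  by_cases h : γ.val 1 0 = 0
  · simp [h]
  · simp only [h, if_false, false_and]
    rw [if_neg (by omega)]

/-- The product formula on the level of signs of bottom-row entries, for matrices
`[[a,b],[c,d]]`, `[[e,f],[g,h]]` of determinant one with product `[[p,q],[r,s]]`. -/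
lemma sign_product_formula {a b c d e f g h p q r s x y z x' y' z' : ℤ}
    (hα : a * d - b * c = 1) (hβ : e * h - f * g = 1) (hαβ : p * s - q * r = 1)
    (hr : r = c * e + d * g) (hs : s = c * f + d * h)
    (hx : x = if c = 0 then d else c) (hy : y = if g = 0 then h else g)
    (hz : z = if r = 0 then s else r) (hx' : x' = if c = 0 then d else -c)
    (hy' : y' = if g = 0 then h else -g) (hz' : z' = if r = 0 then s else -r) :
    ((if ¬(z < 0 ↔ x < 0) ∧ ¬(z < 0 ↔ y < 0) then -1 else 1) *
      (if ¬(z' < 0 ↔ x' < 0) ∧ ¬(z' < 0 ↔ y' < 0) then -1 else 1) : ℤˣ) =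
    (if c = 0 ∧ d < 0 then -1 else 1) * (if g = 0 ∧ h < 0 then -1 else 1) *
      (if r = 0 ∧ s < 0 then -1 else 1) := by
  have unit_of_zero {a b c d : ℤ} (hdet : a * d - b * c = 1) (hc : c = 0) :
      d = 1 ∧ a = 1 ∨ d = -1 ∧ a = -1 := by
    have := Int.mul_eq_one_iff_eq_one_or_neg_one.mp (show a * d = 1 by simpa [hc] using hdet)
    tauto
  by_cases hc : c = 0
  · have hd := unit_of_zero hα hc
    by_cases hg : g = 0
    · have hh := unit_of_zero hβ hg
      rcases hd with ⟨rfl, -⟩ | ⟨rfl, -⟩ <;> rcases hh with ⟨rfl, -⟩ | ⟨rfl, -⟩ <;> simp_all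
    · rcases hd with ⟨rfl, -⟩ | ⟨rfl, -⟩ <;> grind
  · by_cases hg : g = 0
    · rcases unit_of_zero hβ hg with ⟨rfl, rfl⟩ | ⟨rfl, rfl⟩ <;> grind
    · by_cases hr0 : r = 0
      · have hcg : c = -(g * s) := by
          linear_combination (-c) * hβ + h * hr0 - h * hr + g * hs
        rcases unit_of_zero hαβ hr0 with ⟨hs1, -⟩ | ⟨hs1, -⟩ <;> grind
      · rw [if_neg hc] at hx hx'
        rw [if_neg hg] at hy hy'
        rw [if_neg hr0] at hz hz'
        have hiff : (¬(z' < 0 ↔ x' < 0) ∧ ¬(z' < 0 ↔ y' < 0)) ↔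
            (¬(z < 0 ↔ x < 0) ∧ ¬(z < 0 ↔ y < 0)) := by omega
        simp only [hiff, hc, hg, hr0, false_and, if_false, Int.units_mul_self, mul_one]

/-- For all `α, β ∈ SL₂(ℤ)`: `A(α,β)·A(RαR, RβR) = B(α)·B(β)·B(αβ)`. -/
theorem KA_mul_KA_conj (α β : GL2Z) (hα : detZ α = 1) (hβ : detZ β = 1) :
    KA α β * KA (Rm * α * Rm) (Rm * β * Rm) = KB α * KB β * KB (α * β) := by
  have hconj := KA_eq_of_detZ_eq_one (α := Rm * α * Rm) (β := Rm * β * Rm)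
    (by rw [detZ_conj, hα]) (by rw [detZ_conj, hβ])
  have hαβ : detZ (α * β) = 1 := by rw [detZ_mul, hα, hβ, one_mul]
  rw [KA_eq_of_detZ_eq_one hα hβ, hconj, conj_mul_conj, KB_eq, KB_eq, KB_eq]
  rw [detZ_eq] at hα hβ hαβ
  exact sign_product_formula hα hβ hαβ
    (by simp [Matrix.mul_apply, Fin.sum_univ_two])
    (by simp [Matrix.mul_apply, Fin.sum_univ_two])
    rfl rfl rfl (chi_conj α) (chi_conj β) (chi_conj (α * β))
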